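/- Let t be the Tribonacci word and, for i ≥ 0, let N_i = Σ_{j=0}^{i} F_{4j} = F_0 + F_4 + ⋯ + F_{4i}. Then for every i ≥ 2, P^rel_t(N_i) = { (0,0,0), (−1,1,0), (−1,0,1), (0,−1,1), (0,1,−1) } (vectors in ℤ^3 indexed by the letters 0, 1, 2), and consequently AC_t(N_i) = 5; in particular, the abelian complexity of the Tribonacci word attains the value 5 infinitely many times. -/

import Mathlib

/-- The prefix of length `n` of the infinite word `u`. -/
def pref (u : ℕ → ℕ) (n : ℕ) : List ℕ := (List.range n).map u

/-- `w` is a factor of the infinite word `u`. -/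
def IsFactor (u : ℕ → ℕ) (w : List ℕ) : Prop :=
  ∃ i : ℕ, w = (List.range w.length).map (fun j => u (i + j))

/-- The Parikh vector of `w`, viewed as a word over `{0, …, m-1}`. -/
def parikh (m : ℕ) (w : List ℕ) : Fin m → ℤ := fun ℓ => (w.count (ℓ : ℕ) : ℤ)

/-- The set of relative Parikh vectors of factors of `u` of length `n`. -/
def relParikhSet (m : ℕ) (u : ℕ → ℕ) (n : ℕ) : Set (Fin m → ℤ) :=
  { v | ∃ w : List ℕ, IsFactor u w ∧ w.length = n ∧ v = parikh m w - parikh m (pref u n) }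

/-- The extension of a substitution `φ` to finite words. -/
def substW (φ : ℕ → List ℕ) (w : List ℕ) : List ℕ := w.flatMap φ

/-- The `k`-th iterate of the substitution `φ`, applied to the word `w`. -/
def iterW (φ : ℕ → List ℕ) (k : ℕ) (w : List ℕ) : List ℕ := (substW φ)^[k] w

/-- The Tribonacci substitution: 0 ↦ 01, 1 ↦ 02, 2 ↦ 0. -/
def tribo : ℕ → List ℕ
  | 0 => [0, 1]
  | 1 => [0, 2]
  | _ => [0]

/-- `F k = |φ^k(0)|` for the Tribonacci substitution. -/
def triboF (k : ℕ) : ℕ := (iterW tribo k [0]).length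

/-- `φ⁴(a)` for the Tribonacci substitution `φ`. -/
def triboBlock : ℕ → List ℕ
  | 0 => [0, 1, 0, 2, 0, 1, 0, 0, 1, 0, 2, 0, 1]
  | 1 => [0, 1, 0, 2, 0, 1, 0, 0, 1, 0, 2]
  | _ => [0, 1, 0, 2, 0, 1, 0]

/-- The Parikh vector over `{0, 1, 2}` as a triple. -/
def parikhTriple (w : List ℕ) : ℤ × ℤ × ℤ := (w.count 0, w.count 1, w.count 2)

/-- The action of `φ⁴` on Parikh vectors. -/
def blockMatrix (u : ℤ × ℤ × ℤ) : ℤ × ℤ × ℤ :=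
  (7 * u.1 + 6 * u.2.1 + 4 * u.2.2, 4 * u.1 + 3 * u.2.1 + 2 * u.2.2, 2 * u.1 + 2 * u.2.1 + u.2.2)

/-- The length of `φ⁴(w)` as a function of the Parikh vector of `w`. -/
def blockLength (u : ℤ × ℤ × ℤ) : ℤ := 13 * u.1 + 11 * u.2.1 + 7 * u.2.2

/-- A prefix of `φ⁴(b c d e)` that does not depend on the letter `e`. -/
def blockContext (b c d : ℕ) : List ℕ :=
  triboBlock b ++ triboBlock c ++ triboBlock d ++ triboBlock 2

/-- A relative Parikh vector, together with the letter at the start of a factor and the three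
letters from its last letter on. -/
abbrev WindowState : Type := (ℤ × ℤ × ℤ) × ℕ × ℕ × ℕ × ℕ

/-- The state of the factor of length `K + 1` at position `m`; the last letter of the factor is
left out of the vector. -/
def windowState (t : ℕ → ℕ) (K m : ℕ) : WindowState :=
  (parikhTriple (pref t (m + K)) - parikhTriple (pref t m) - parikhTriple (pref t (K + 1)),
    t m, t (m + K), t (m + K + 1), t (m + K + 2))

/-- The distance from the image of the last letter of a factor to the last letter of the factor
that starts at offset `r` in the image of its first letter. -/
def stepOffset (s : WindowState) (r : ℕ) : ℤ := r - blockLength s.1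

/-- The effect on states of applying `φ⁴` and moving to offset `r` in the first block. -/
def stepState (s : WindowState) (r : ℕ) : WindowState :=
  let k := (stepOffset s r).toNat
  let W := blockContext s.2.2.1 s.2.2.2.1 s.2.2.2.2
  (blockMatrix s.1 + parikhTriple (W.take k) - parikhTriple ((triboBlock s.2.1).take r) - (1, 0, 0),
    (triboBlock s.2.1).getD r 0, W.getD k 0, W.getD (k + 1) 0, W.getD (k + 2) 0)

/-- The offset stays inside the known context. -/
def ValidStep (s : WindowState) (r : ℕ) : Prop :=
  r < (triboBlock s.2.1).length ∧ 0 ≤ stepOffset s r ∧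
    (stepOffset s r).toNat + 2 < (blockContext s.2.2.1 s.2.2.2.1 s.2.2.2.2).length

instance (s : WindowState) (r : ℕ) : Decidable (ValidStep s r) := by
  unfold ValidStep; infer_instance

/-- The state of the factor of length `1` at offset `r` of a context. -/
def contextState (b c d r : ℕ) : WindowState :=
  let W := blockContext b c d
  ((-1, 0, 0), W.getD r 0, W.getD r 0, W.getD (r + 1) 0, W.getD (r + 2) 0)

/-- The relative Parikh vector of the full factor. -/
def stateVector (s : WindowState) : ℤ × ℤ × ℤ := s.1 + parikhTriple [s.2.2.1]

/-- A set of states that contains those of `K = 0` and is closed under `stepState`. -/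
def reachableStates : List WindowState :=
  [((-2, 0, 1), 1, 0, 1, 0),
   ((-2, 0, 1), 2, 0, 0, 1),
   ((-1, -1, 1), 0, 0, 1, 0),
   ((-1, -1, 1), 0, 1, 0, 0),
   ((-1, -1, 1), 2, 1, 0, 0),
   ((-1, -1, 1), 2, 1, 0, 1),
   ((-1, 0, 0), 0, 0, 0, 1),
   ((-1, 0, 0), 0, 0, 1, 0),
   ((-1, 0, 0), 0, 0, 2, 0),
   ((-1, 0, 0), 0, 2, 0, 1),
   ((-1, 0, 0), 1, 0, 1, 0),
   ((-1, 0, 0), 1, 1, 0, 0),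
   ((-1, 0, 0), 1, 1, 0, 1),
   ((-1, 0, 0), 1, 1, 0, 2),
   ((-1, 0, 0), 1, 2, 0, 1),
   ((-1, 0, 0), 2, 0, 1, 0),
   ((-1, 0, 0), 2, 0, 2, 0),
   ((-1, 0, 0), 2, 2, 0, 1),
   ((-1, 1, -1), 1, 0, 2, 0),
   ((0, -1, 0), 0, 1, 0, 1),
   ((0, -1, 0), 0, 1, 0, 2),
   ((0, 0, -1), 0, 1, 0, 2),
   ((0, 0, -1), 0, 2, 0, 1)]

instance (s : WindowState) : Decidable (s ∈ reachableStates) := inferInstance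

/-- The relative Parikh vectors that occur. -/
def fiveVectors : List (ℤ × ℤ × ℤ) :=
  [(0, 0, 0), (-1, 1, 0), (-1, 0, 1), (0, -1, 1), (0, 1, -1)]

theorem stepState_mem_reachableStates :
    ∀ s ∈ reachableStates, ∀ r < (triboBlock s.2.1).length,
      ValidStep s r ∧ stepState s r ∈ reachableStates := by
  decide +kernel

theorem stateVector_mem_fiveVectors :
    ∀ s ∈ reachableStates, stateVector s ∈ fiveVectors := by
  decide +kernel

theorem exists_two_steps :
    ∀ v ∈ fiveVectors,
      ∃ s ∈ ([((-1, 0, 0), 0, 0, 1, 0), ((-1, 0, 0), 1, 1, 0, 2)] : List WindowState),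
        ∃ r < 13, ∃ r' < 13, ValidStep s r ∧ ValidStep (stepState s r) r' ∧
          stateVector (stepState (stepState s r) r') = v := by
  decide +kernel

theorem contextState_mem_reachableStates :
    ∀ b < 3, ∀ c < 3, ∀ d < 3, ∀ r < (triboBlock b).length,
      contextState b c d r ∈ reachableStates := by
  decide +kernel

section Words

theorem parikhTriple_append (v w : List ℕ) :
    parikhTriple (v ++ w) = parikhTriple v + parikhTriple w := by
  simp [parikhTriple]

theorem parikhTriple_flatMap (w : List ℕ) (hw : ∀ a ∈ w, a < 3) :
    parikhTriple (w.flatMap triboBlock) = blockMatrix (parikhTriple w) := by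
  induction w with
  | nil => decide
  | cons a w ih =>
    have hM : ∀ u v, blockMatrix (u + v) = blockMatrix u + blockMatrix v := by
      intro u v
      simp only [blockMatrix, Prod.fst_add, Prod.snd_add, Prod.mk_add_mk, Prod.mk.injEq]
      refine ⟨?_, ?_, ?_⟩ <;> ring
    have ha : a < 3 := hw a (by simp)
    rw [← List.singleton_append, List.flatMap_append, parikhTriple_append, parikhTriple_append, hM,
      ih fun b hb => hw b (by simp [hb])]
    congr 1
    interval_cases a <;> decide

theorem length_flatMap_triboBlock (w : List ℕ) (hw : ∀ a ∈ w, a < 3) :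
    ((w.flatMap triboBlock).length : ℤ) = blockLength (parikhTriple w) := by
  induction w with
  | nil => decide
  | cons a w ih =>
    have ha : a < 3 := hw a (by simp)
    have hL : ∀ u v, blockLength (u + v) = blockLength u + blockLength v := by
      intro u v
      simp only [blockLength, Prod.fst_add, Prod.snd_add]
      ring
    rw [← List.singleton_append, List.flatMap_append, parikhTriple_append, hL, List.length_append,
      Nat.cast_add, ih fun b hb => hw b (by simp [hb])]
    congr 1
    interval_cases a <;> decide

theorem iterW_four_eq_flatMap (w : List ℕ) : iterW tribo 4 w = w.flatMap triboBlock := by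
  simp only [iterW, Function.iterate_succ, Function.iterate_zero, Function.comp_apply, id_eq,
    substW, List.flatMap_assoc]
  congr 1
  funext a
  rcases a with _ | _ | a <;> rfl

theorem iterW_add_four (k : ℕ) (w : List ℕ) :
    iterW tribo (k + 4) w = (iterW tribo k w).flatMap triboBlock := by
  rw [← iterW_four_eq_flatMap]
  simp only [iterW, ← Function.iterate_add_apply, add_comm]

theorem lt_length_iterW (k : ℕ) :
    k < (iterW tribo k [0]).length ∧ 0 ∈ iterW tribo k [0] := by
  induction k with
  | zero => simp [iterW]
  | succ k ih =>
    have hle : ∀ w : List ℕ, w.length + w.count 0 ≤ (substW tribo w).length := by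
      intro w
      induction w with
      | nil => simp
      | cons a w ih =>
        rcases a with _ | _ | a <;> simp [substW, tribo] at ih ⊢ <;> omega
    have hs : iterW tribo (k + 1) [0] = substW tribo (iterW tribo k [0]) := by
      simp only [iterW, Function.iterate_succ_apply']
    rw [hs]
    have hc := List.count_pos_iff.mpr ih.2
    refine ⟨by have := hle (iterW tribo k [0]); omega, ?_⟩
    exact List.mem_flatMap.mpr ⟨0, ih.2, by simp [tribo]⟩

theorem pref_length (u : ℕ → ℕ) (n : ℕ) : (pref u n).length = n := by
  simp [pref]

theorem pref_succ (u : ℕ → ℕ) (n : ℕ) : pref u (n + 1) = pref u n ++ [u n] := by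
  simp [pref, List.range_succ]

theorem pref_add (u : ℕ → ℕ) (m n : ℕ) :
    pref u (m + n) = pref u m ++ (List.range n).map fun j => u (m + j) := by
  simp [pref, List.range_add]

theorem pref_prefix_pref (u : ℕ → ℕ) {m n : ℕ} (h : m ≤ n) : pref u m <+: pref u n := by
  obtain ⟨k, rfl⟩ := Nat.exists_eq_add_of_le h
  exact ⟨_, (pref_add u m k).symm⟩

theorem eq_pref_of_prefix {u : ℕ → ℕ} {w : List ℕ} {n : ℕ} (h : w <+: pref u n) :
    w = pref u w.length :=
  have hl : w.length ≤ n := by simpa [pref_length] using h.length_le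
  (List.prefix_of_prefix_length_le h (pref_prefix_pref u hl) (by simp [pref_length])).eq_of_length
    (by simp [pref_length])

theorem parikh_sub_parikh_pref (u : ℕ → ℕ) (i n : ℕ) :
    parikh 3 ((List.range n).map fun j => u (i + j)) - parikh 3 (pref u n) =
      let v := parikhTriple (pref u (i + n)) - parikhTriple (pref u i) - parikhTriple (pref u n)
      ![v.1, v.2.1, v.2.2] := by
  rw [pref_add]
  funext ℓ
  fin_cases ℓ <;> simp [parikh, parikhTriple]

theorem mem_relParikhSet_iff (u : ℕ → ℕ) (n : ℕ) (x : Fin 3 → ℤ) :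
    x ∈ relParikhSet 3 u n ↔ ∃ i,
      let v := parikhTriple (pref u (i + n)) - parikhTriple (pref u i) - parikhTriple (pref u n)
      x = ![v.1, v.2.1, v.2.2] := by
  constructor
  · rintro ⟨w, ⟨i, hi⟩, rfl, rfl⟩
    exact ⟨i, (congrArg (fun v => parikh 3 v - parikh 3 (pref u w.length)) hi).trans
      (parikh_sub_parikh_pref u i w.length)⟩
  · rintro ⟨i, hi⟩
    refine ⟨(List.range n).map fun j => u (i + j), ⟨i, by simp⟩, by simp, ?_⟩
    rw [hi, parikh_sub_parikh_pref]

end Words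

/-- The length of the image of `t_[n]` under `φ⁴`. -/
def blockStart (t : ℕ → ℕ) (n : ℕ) : ℕ := ((pref t n).flatMap triboBlock).length

section Tribonacci

variable {t : ℕ → ℕ}

theorem lt_three_of_mem_pref (ht : ∀ i, t i < 3) (n : ℕ) : ∀ a ∈ pref t n, a < 3 := by
  intro a ha
  obtain ⟨i, -, rfl⟩ := List.mem_map.mp ha
  exact ht i

theorem blockStart_succ (n : ℕ) :
    blockStart t (n + 1) = blockStart t n + (triboBlock (t n)).length := by
  simp [blockStart, pref_succ]

theorem flatMap_pref (htfix : ∀ k : ℕ, iterW tribo k [0] = pref t (iterW tribo k [0]).length)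
    (n : ℕ) : (pref t n).flatMap triboBlock = pref t (blockStart t n) := by
  have h := htfix (n + 4)
  rw [iterW_add_four, htfix n] at h
  have hp := (pref_prefix_pref t (lt_length_iterW n).1.le).flatMap triboBlock
  rw [h] at hp
  exact eq_pref_of_prefix hp

theorem pref_blockStart_add
    (htfix : ∀ k : ℕ, iterW tribo k [0] = pref t (iterW tribo k [0]).length) (n s : ℕ)
    (hs : s ≤ (blockContext (t n) (t (n + 1)) (t (n + 2))).length) :
    pref t (blockStart t n + s) =
      pref t (blockStart t n) ++ (blockContext (t n) (t (n + 1)) (t (n + 2))).take s := by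
  have hB : triboBlock 2 <+: triboBlock (t (n + 3)) := by
    rcases t (n + 3) with _ | _ | a
    · exact ⟨[0, 1, 0, 2, 0, 1], rfl⟩
    · exact ⟨[0, 1, 0, 2], rfl⟩
    · exact ⟨[], rfl⟩
  obtain ⟨r, hr⟩ := hB
  have h := flatMap_pref htfix (n + 4)
  simp only [show n + 4 = n + 1 + 1 + 1 + 1 from rfl, pref_succ, List.flatMap_append,
    List.flatMap_singleton] at h
  have hp : pref t (blockStart t n) ++ (blockContext (t n) (t (n + 1)) (t (n + 2))).take s <+:
      pref t (blockStart t (n + 4)) := by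
    rw [← h, ← flatMap_pref htfix n]
    simp only [List.append_assoc]
    refine (List.prefix_append_right_inj _).mpr ((List.take_prefix _ _).trans ⟨r, ?_⟩)
    rw [← hr]
    simp [blockContext]
  have := eq_pref_of_prefix hp
  rw [this]
  simp [pref_length, hs]

theorem apply_blockStart_add
    (htfix : ∀ k : ℕ, iterW tribo k [0] = pref t (iterW tribo k [0]).length) (n s : ℕ)
    (hs : s < (blockContext (t n) (t (n + 1)) (t (n + 2))).length) :
    t (blockStart t n + s) = (blockContext (t n) (t (n + 1)) (t (n + 2))).getD s 0 := by
  have h := pref_blockStart_add htfix n (s + 1) hs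
  rw [← add_assoc, pref_succ, pref_blockStart_add htfix n s hs.le, List.append_assoc,
    List.append_cancel_left_eq, List.take_succ_eq_append_getElem hs,
    List.append_cancel_left_eq] at h
  rw [List.getD_eq_getElem _ _ hs]
  simpa using h

theorem cast_blockStart (ht : ∀ i, t i < 3) (n : ℕ) :
    (blockStart t n : ℤ) = blockLength (parikhTriple (pref t n)) :=
  length_flatMap_triboBlock _ (lt_three_of_mem_pref ht n)

theorem parikhTriple_pref_blockStart (ht : ∀ i, t i < 3)
    (htfix : ∀ k : ℕ, iterW tribo k [0] = pref t (iterW tribo k [0]).length) (n : ℕ) :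
    parikhTriple (pref t (blockStart t n)) = blockMatrix (parikhTriple (pref t n)) := by
  rw [← flatMap_pref htfix, parikhTriple_flatMap _ (lt_three_of_mem_pref ht n)]

theorem triboBlock_prefix_blockContext (b c d : ℕ) : triboBlock b <+: blockContext b c d := by
  simp [blockContext]

theorem apply_blockStart
    (htfix : ∀ k : ℕ, iterW tribo k [0] = pref t (iterW tribo k [0]).length) (n : ℕ) :
    t (blockStart t n) = 0 := by
  have h := apply_blockStart_add htfix n 0 (by simp [blockContext, triboBlock])
  rw [add_zero] at h
  rw [h]
  rcases t n with _ | _ | a <;> rfl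

theorem windowState_blockStart (ht : ∀ i, t i < 3)
    (htfix : ∀ k : ℕ, iterW tribo k [0] = pref t (iterW tribo k [0]).length) (K m r : ℕ)
    (hv : ValidStep (windowState t K m) r) :
    windowState t (blockStart t (K + 1)) (blockStart t m + r) =
      stepState (windowState t K m) r := by
  obtain ⟨hr, h0, hk⟩ := hv
  obtain ⟨k, hk'⟩ := Int.eq_ofNat_of_zero_le h0
  rw [hk', Int.toNat_natCast] at hk
  have hpos : blockStart t m + r + blockStart t (K + 1) = blockStart t (m + K) + k := by
    zify
    rw [cast_blockStart ht, cast_blockStart ht, cast_blockStart ht]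
    simp only [stepOffset, windowState, blockLength, Prod.fst_sub, Prod.snd_sub] at hk' ⊢
    linarith
  have hpre := triboBlock_prefix_blockContext (t m) (t (m + 1)) (t (m + 2))
  have hrc := hr.trans_le hpre.length_le
  simp only [windowState] at hr hk hrc
  have hp1 : parikhTriple (pref t (blockStart t m + r)) =
      blockMatrix (parikhTriple (pref t m)) + parikhTriple ((triboBlock (t m)).take r) := by
    rw [pref_blockStart_add htfix m r hrc.le, parikhTriple_append,
      parikhTriple_pref_blockStart ht htfix]
    obtain ⟨x, hx⟩ := hpre
    rw [← hx, List.take_append_of_le_length hr.le]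
  have ht1 : t (blockStart t m + r) = (triboBlock (t m)).getD r 0 := by
    rw [apply_blockStart_add htfix m r hrc]
    obtain ⟨x, hx⟩ := hpre
    rw [← hx, List.getD_append _ _ _ _ hr]
  have hp2 : parikhTriple (pref t (blockStart t (m + K) + k)) =
      blockMatrix (parikhTriple (pref t (m + K))) +
        parikhTriple ((blockContext (t (m + K)) (t (m + K + 1)) (t (m + K + 2))).take k) := by
    rw [pref_blockStart_add htfix _ k (by omega), parikhTriple_append,
      parikhTriple_pref_blockStart ht htfix]
  have hp3 : parikhTriple (pref t (blockStart t (K + 1) + 1)) =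
      blockMatrix (parikhTriple (pref t (K + 1))) + (1, 0, 0) := by
    rw [pref_succ, parikhTriple_append, parikhTriple_pref_blockStart ht htfix,
      apply_blockStart htfix]
    rfl
  simp only [stepState, hk', Int.toNat_natCast]
  simp only [windowState, hpos, hp1, hp2, hp3, ht1, add_assoc (blockStart t (m + K))]
  rw [apply_blockStart_add htfix _ k (by omega), apply_blockStart_add htfix _ (k + 1) (by omega),
    apply_blockStart_add htfix _ (k + 2) (by omega)]
  congr 1
  simp only [blockMatrix, Prod.ext_iff, Prod.fst_add, Prod.snd_add, Prod.fst_sub, Prod.snd_sub]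
  refine ⟨?_, ?_, ?_⟩ <;> ring

theorem exists_eq_blockStart_add (n : ℕ) :
    ∃ m r, r < (triboBlock (t m)).length ∧ n = blockStart t m + r := by
  induction n with
  | zero =>
    exact ⟨0, 0, by rcases t 0 with _ | _ | a <;> simp [triboBlock], by simp [blockStart, pref]⟩
  | succ n ih =>
    obtain ⟨m, r, hr, rfl⟩ := ih
    by_cases h : r + 1 < (triboBlock (t m)).length
    · exact ⟨m, r + 1, h, rfl⟩
    · refine ⟨m + 1, 0, by rcases t (m + 1) with _ | _ | a <;> simp [triboBlock], ?_⟩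
      rw [blockStart_succ]
      omega

theorem pref_four (htfix : ∀ k : ℕ, iterW tribo k [0] = pref t (iterW tribo k [0]).length) :
    pref t 4 = [0, 1, 0, 2] :=
  (htfix 2).symm

theorem windowState_zero_mem (ht : ∀ i, t i < 3)
    (htfix : ∀ k : ℕ, iterW tribo k [0] = pref t (iterW tribo k [0]).length) (n : ℕ) :
    windowState t 0 n ∈ reachableStates := by
  obtain ⟨m, r, hr, rfl⟩ := exists_eq_blockStart_add (t := t) n
  have h := contextState_mem_reachableStates _ (ht m) _ (ht (m + 1)) _ (ht (m + 2)) r hr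
  have hlen : (triboBlock (t m)).length + 2 <
      (blockContext (t m) (t (m + 1)) (t (m + 2))).length := by
    simp only [blockContext, List.length_append, triboBlock, List.length_cons, List.length_nil]
    omega
  have h0 : t 0 = 0 := apply_blockStart htfix 0
  convert h using 1
  simp only [windowState, contextState, add_zero, zero_add, add_assoc (blockStart t m)]
  rw [apply_blockStart_add htfix _ r (by omega), apply_blockStart_add htfix _ (r + 1) (by omega),
    apply_blockStart_add htfix _ (r + 2) (by omega)]
  congr 1
  simp [pref, h0, parikhTriple]

/-- The sequence `N_i - 1`. -/
def levelIndex (t : ℕ → ℕ) : ℕ → ℕ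
  | 0 => 0
  | i + 1 => blockStart t (levelIndex t i + 1)

theorem levelIndex_add_one
    (htfix : ∀ k : ℕ, iterW tribo k [0] = pref t (iterW tribo k [0]).length) (i : ℕ) :
    levelIndex t i + 1 = ∑ j ∈ Finset.range (i + 1), triboF (4 * j) := by
  have key : ∀ i, ∃ w, w.length = ∑ j ∈ Finset.range (i + 1), triboF (4 * j) ∧
      w = pref t (levelIndex t i + 1) ∧
      w.flatMap triboBlock ++ [0] = iterW tribo (4 * (i + 1)) [0] ++ w := by
    intro i
    induction i with
    | zero =>
      refine ⟨[0], rfl, htfix 0, ?_⟩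
      simp [iterW_four_eq_flatMap]
    | succ i ih =>
      obtain ⟨w, hl, hp, hw⟩ := ih
      refine ⟨iterW tribo (4 * (i + 1)) [0] ++ w, ?_, ?_, ?_⟩
      · rw [Finset.sum_range_succ, ← hl, List.length_append, add_comm, triboF]
      · rw [← hw, levelIndex, pref_succ, apply_blockStart htfix, ← flatMap_pref htfix, ← hp]
      · rw [List.flatMap_append, List.append_assoc, hw, ← iterW_add_four]
        rfl
  obtain ⟨w, hl, hp, -⟩ := key i
  rw [← hl, hp, pref_length]

theorem windowState_mem_reachableStates (ht : ∀ i, t i < 3)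
    (htfix : ∀ k : ℕ, iterW tribo k [0] = pref t (iterW tribo k [0]).length) (i n : ℕ) :
    windowState t (levelIndex t i) n ∈ reachableStates := by
  induction i generalizing n with
  | zero => exact windowState_zero_mem ht htfix n
  | succ i ih =>
    obtain ⟨m, r, hr, rfl⟩ := exists_eq_blockStart_add (t := t) n
    obtain ⟨hv, hs⟩ := stepState_mem_reachableStates _ (ih m) r hr
    rw [levelIndex, windowState_blockStart ht htfix _ m r hv]
    exact hs

theorem windowState_levelIndex_zero_one (ht : ∀ i, t i < 3)
    (htfix : ∀ k : ℕ, iterW tribo k [0] = pref t (iterW tribo k [0]).length) (i : ℕ) :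
    windowState t (levelIndex t i) 0 = ((-1, 0, 0), 0, 0, 1, 0) ∧
      windowState t (levelIndex t i) 1 = ((-1, 0, 0), 1, 1, 0, 2) := by
  induction i with
  | zero =>
    have h := pref_four htfix
    simp only [pref, List.range_succ, List.range_zero, List.nil_append,
      List.map_cons, List.map_nil, List.cons_append, List.cons.injEq, and_true] at h
    obtain ⟨h0, h1, h2, h3⟩ := h
    constructor <;> simp [windowState, levelIndex, pref, parikhTriple, List.range_succ, *]
  | succ i ih =>
    have hb : blockStart t 0 = 0 := rfl
    have h0 := windowState_blockStart ht htfix (levelIndex t i) 0 0 (by rw [ih.1]; decide +kernel)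
    have h1 := windowState_blockStart ht htfix (levelIndex t i) 0 1 (by rw [ih.1]; decide +kernel)
    rw [ih.1, hb] at h0 h1
    exact ⟨h0.trans (by decide +kernel), h1.trans (by decide +kernel)⟩

theorem stateVector_windowState (K n : ℕ) :
    stateVector (windowState t K n) = parikhTriple (pref t (n + (K + 1))) -
      parikhTriple (pref t n) - parikhTriple (pref t (K + 1)) := by
  simp only [stateVector, windowState, ← add_assoc, pref_succ t (n + K), parikhTriple_append]
  abel

theorem exists_stateVector_eq (ht : ∀ i, t i < 3)
    (htfix : ∀ k : ℕ, iterW tribo k [0] = pref t (iterW tribo k [0]).length) (i : ℕ)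
    (v : ℤ × ℤ × ℤ) (hv : v ∈ fiveVectors) :
    ∃ n, stateVector (windowState t (levelIndex t (i + 2)) n) = v := by
  obtain ⟨s, hs, r, -, r', -, h1, h2, h3⟩ := exists_two_steps v hv
  obtain ⟨m, hm⟩ : ∃ m, windowState t (levelIndex t i) m = s := by
    have h := windowState_levelIndex_zero_one ht htfix i
    simp only [List.mem_cons, List.not_mem_nil, or_false] at hs
    rcases hs with rfl | rfl
    exacts [⟨0, h.1⟩, ⟨1, h.2⟩]
  subst hm
  rw [← windowState_blockStart ht htfix _ _ _ h1] at h2 h3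
  rw [← windowState_blockStart ht htfix _ _ _ h2] at h3
  exact ⟨_, h3⟩

theorem relParikhSet_levelIndex (ht : ∀ i, t i < 3)
    (htfix : ∀ k : ℕ, iterW tribo k [0] = pref t (iterW tribo k [0]).length) (i : ℕ) :
    relParikhSet 3 t (levelIndex t (i + 2) + 1) =
      ({![0, 0, 0], ![-1, 1, 0], ![-1, 0, 1], ![0, -1, 1], ![0, 1, -1]} :
        Set (Fin 3 → ℤ)) := by
  ext x
  have hx : x ∈ ({![0, 0, 0], ![-1, 1, 0], ![-1, 0, 1], ![0, -1, 1], ![0, 1, -1]} :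
      Set (Fin 3 → ℤ)) ↔ ∃ v ∈ fiveVectors, x = ![v.1, v.2.1, v.2.2] := by
    simp [fiveVectors]
  rw [hx, mem_relParikhSet_iff]
  simp only [← stateVector_windowState]
  constructor
  · rintro ⟨n, hn⟩
    exact ⟨_, stateVector_mem_fiveVectors _ (windowState_mem_reachableStates ht htfix _ n), hn⟩
  · rintro ⟨v, hv, rfl⟩
    obtain ⟨n, rfl⟩ := exists_stateVector_eq ht htfix i v hv
    exact ⟨n, rfl⟩

end Tribonacci

theorem stmt16 (t : ℕ → ℕ) (ht : ∀ i, t i < 3)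
    (htfix : ∀ k : ℕ, iterW tribo k [0] = pref t (iterW tribo k [0]).length)
    (N : ℕ → ℕ) (hN : ∀ i, N i = ∑ j ∈ Finset.range (i + 1), triboF (4 * j)) :
    (∀ i : ℕ, 2 ≤ i →
      relParikhSet 3 t (N i) =
        ({![0, 0, 0], ![-1, 1, 0], ![-1, 0, 1], ![0, -1, 1], ![0, 1, -1]} :
          Set (Fin 3 → ℤ)) ∧
      (relParikhSet 3 t (N i)).ncard = 5) ∧
    { n : ℕ | (relParikhSet 3 t n).ncard = 5 }.Infinite := by
  have hset : ∀ i : ℕ, 2 ≤ i →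
      relParikhSet 3 t (N i) =
        ({![0, 0, 0], ![-1, 1, 0], ![-1, 0, 1], ![0, -1, 1], ![0, 1, -1]} :
          Set (Fin 3 → ℤ)) := by
    intro i hi
    obtain ⟨j, rfl⟩ := Nat.exists_eq_add_of_le' hi
    rw [hN, ← levelIndex_add_one htfix, relParikhSet_levelIndex ht htfix]
  have hcard : ∀ i : ℕ, 2 ≤ i → (relParikhSet 3 t (N i)).ncard = 5 := by
    intro i hi
    have hfin : ({![0, 0, 0], ![-1, 1, 0], ![-1, 0, 1], ![0, -1, 1], ![0, 1, -1]} :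
        Set (Fin 3 → ℤ)) =
        (({![0, 0, 0], ![-1, 1, 0], ![-1, 0, 1], ![0, -1, 1], ![0, 1, -1]} :
          Finset (Fin 3 → ℤ)) : Set (Fin 3 → ℤ)) := by
      simp
    rw [hset i hi, hfin, Set.ncard_coe_finset]
    decide +kernel
  refine ⟨fun i hi => ⟨hset i hi, hcard i hi⟩, ?_⟩
  have hmono : StrictMono N := by
    refine strictMono_nat_of_lt_succ fun i => ?_
    rw [hN, hN, Finset.sum_range_succ _ (i + 1)]
    have := (lt_length_iterW (4 * (i + 1))).1
    simp only [triboF]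
    omega
  exact Set.infinite_of_injective_forall_mem
    (hmono.injective.comp (add_left_injective 2)) fun i => hcard (i + 2) (by omega)
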